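/- arXiv:1209.0612 — 7 statements merged into one kernel-verified Lean document; each statement's English description precedes it below -/
import Mathlib

section
/- For every integer i ≥ 1, (A_{i+2} + A_{i+1})² − (A_{i+1} + A_i)·(A_{i+2} + A_{i+3}) = n + 2. -/
/-- The sequence `A_i` for the wild Kronecker quiver `K_n`:
`A_0 = 0`, `A_1 = 1`, `A_{i+2} = n·A_{i+1} − A_i`. -/
def kroneckerA (n : ℤ) : ℕ → ℤ
  | 0 => 0
  | 1 => 1
  | (i + 2) => n * kroneckerA n (i + 1) - kroneckerA n i

/-- The quadratic form `x² - nxy + y²` is invariant along the recursion. -/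
theorem kroneckerA_sq_add_sq_sub (n : ℤ) (i : ℕ) :
    kroneckerA n (i + 1) ^ 2 + kroneckerA n i ^ 2
      - n * kroneckerA n (i + 1) * kroneckerA n i = 1 := by
  induction i with
  | zero => simp [kroneckerA]
  | succ k ih =>
    rw [kroneckerA]
    linear_combination ih

theorem stmt_2 (n : ℤ) (hn : 3 ≤ n) (i : ℕ) (hi : 1 ≤ i) :
    (kroneckerA n (i + 2) + kroneckerA n (i + 1)) ^ 2
      - (kroneckerA n (i + 1) + kroneckerA n i)
        * (kroneckerA n (i + 2) + kroneckerA n (i + 3)) = n + 2 := by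
  rw [show kroneckerA n (i + 3) = n * kroneckerA n (i + 2) - kroneckerA n (i + 1) from rfl,
    show kroneckerA n (i + 2) = n * kroneckerA n (i + 1) - kroneckerA n i from rfl]
  linear_combination (n + 2) * kroneckerA_sq_add_sq_sub n i
end

section
/- Let n ≥ 4 and let (c,d) be a pair of positive integers with c² + d² − (n−1)·c·d < 0 (an imaginary root of K_{n−1}). Let (a,b) = (c,d)·Φ_n, where Φ_n is the 2×2 integer matrix with rows (n²−1, n) and (−n, −1). Then (a,b) is not a root of K_{n−1}; that is, a² + b² − (n−1)·a·b is neither equal to 1 nor negative. -/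
theorem stmt_6 (n : ℤ) (hn : 4 ≤ n) (c d : ℤ) (hc : 0 < c) (hd : 0 < d)
    (him : c ^ 2 + d ^ 2 - (n - 1) * c * d < 0)
    (a b : ℤ)
    (hab : ![a, b] = Matrix.vecMul ![c, d] !![n ^ 2 - 1, n; -n, -1]) :
    a ^ 2 + b ^ 2 - (n - 1) * a * b ≠ 1 ∧
    ¬ (a ^ 2 + b ^ 2 - (n - 1) * a * b < 0) := by
  have ha : a = c * (n ^ 2 - 1) - d * n := by
    have h := congrFun hab 0
    simp [Matrix.vecMul, dotProduct, Fin.sum_univ_two] at h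
    linarith
  have hb : b = c * n - d := by
    have h := congrFun hab 1
    simp [Matrix.vecMul, dotProduct, Fin.sum_univ_two] at h
    linarith
  have key : a ^ 2 + b ^ 2 - (n - 1) * a * b
      = (n + 1) * (((n - 1) * c - d) * (n * c - d)) + c ^ 2 := by
    rw [ha, hb]; ring
  have hu : 0 < (n - 1) * c - d := by
    have h : 0 < d * ((n - 1) * c - d) := by nlinarith [sq_nonneg c]
    exact pos_of_mul_pos_right h hd.le
  have hv : 0 < n * c - d := by linarith
  have hpos : 0 < (n + 1) * (((n - 1) * c - d) * (n * c - d)) := by positivity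
  have hc2 : 0 < c ^ 2 := by positivity
  rw [key]
  constructor <;> omega
end

section
/- Let (a,b) ∈ ℤ² and define vectors v_r ∈ ℤ² for r ≥ 1 by v_1 = (a,b), v_2 = (n·b, n²·b − n·a), and for r ≥ 2: v_{r+1} = v_r·Φ + v_r − v_{r−1} if r+1 is odd, and v_{r+1} = v_r·Φ^{−1} + v_r − v_{r−1} if r+1 is even. Then for every r ≥ 1: v_r = A_r·(a, b) if r is odd, and v_r = A_r·(b, n·b − a) if r is even. -/
theorem stmt_8 (n : ℤ) (hn : 3 ≤ n) (a b : ℤ)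
    (v : ℕ → Fin 2 → ℤ)
    (hv1 : v 1 = ![a, b])
    (hv2 : v 2 = ![n * b, n ^ 2 * b - n * a])
    (hrec : ∀ r : ℕ, 2 ≤ r →
      v (r + 1) =
        (if Odd (r + 1)
          then Matrix.vecMul (v r) !![n ^ 2 - 1, n; -n, -1]
          else Matrix.vecMul (v r) !![-1, -n; n, n ^ 2 - 1])
        + v r - v (r - 1)) :
    ∀ r : ℕ, 1 ≤ r →
      (Odd r → v r = kroneckerA n r • ![a, b]) ∧
      (Even r → v r = kroneckerA n r • ![b, n * b - a]) := by
  have step (c d : ℤ) (x y : Fin 2 → ℤ) (M : Matrix (Fin 2) (Fin 2) ℤ)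
      (h : Matrix.vecMul x M + x = n • y) :
      Matrix.vecMul (c • x) M + c • x - d • y = (n * c - d) • y := by
    rw [Matrix.smul_vecMul, ← smul_add, h, smul_smul, sub_smul, mul_comm]
  have hodd : Matrix.vecMul ![b, n * b - a] !![n ^ 2 - 1, n; -n, -1] + ![b, n * b - a]
      = n • ![a, b] := by
    ext i
    fin_cases i <;> simp <;> ring
  have heven : Matrix.vecMul ![a, b] !![-1, -n; n, n ^ 2 - 1] + ![a, b]
      = n • ![b, n * b - a] := by
    ext i
    fin_cases i <;> simp <;> ring
  have key (k : ℕ) : v (2 * k + 1) = kroneckerA n (2 * k + 1) • ![a, b] ∧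
      v (2 * k + 2) = kroneckerA n (2 * k + 2) • ![b, n * b - a] := by
    induction k with
    | zero =>
      refine ⟨by simp [hv1, kroneckerA], ?_⟩
      rw [hv2]
      ext i
      fin_cases i <;> simp [kroneckerA] <;> ring
    | succ k ih =>
      obtain ⟨h1, h2⟩ := ih
      have h3 : v (2 * k + 3) = kroneckerA n (2 * k + 3) • ![a, b] := by
        have h := hrec (2 * k + 2) (by omega)
        rw [if_pos ⟨k + 1, by ring⟩, Nat.add_sub_assoc (by norm_num), h1, h2,
          step _ _ _ _ _ hodd] at h
        exact h
      refine ⟨h3, ?_⟩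
      have h := hrec (2 * k + 3) (by omega)
      rw [if_neg (Nat.not_odd_iff_even.mpr ⟨k + 2, by ring⟩),
        Nat.add_sub_assoc (by norm_num), h2, h3, step _ _ _ _ _ heven] at h
      exact h
  intro r hr
  constructor
  · rintro ⟨k, rfl⟩
    exact (key k).1
  · rintro ⟨k, rfl⟩
    obtain ⟨m, rfl⟩ : ∃ m, k = m + 1 := ⟨k - 1, by omega⟩
    rw [show m + 1 + (m + 1) = 2 * m + 2 by ring]
    exact (key m).2
end

section
/- Let k be an algebraically closed field, n ≥ 3 an integer, and (a,b) a pair of positive integers with a² + b² − n·a·b < 0 (a positive imaginary root of K_n). Then there exist n matrices M_1, …, M_n of size a×b over k such that the only pairs (φ, ψ), with φ an a×a matrix and ψ a b×b matrix over k satisfying φ·M_i = M_i·ψ for all i = 1, …, n, are the scalar pairs (λ·I_a, λ·I_b) for λ ∈ k. (Equivalently, the representation of the wild Kronecker quiver K_n with dimension vector (a,b) given by the matrices M_i is a brick, i.e., has endomorphism ring k.) -/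
/-- A family of matrices, seen as a representation of a Kronecker quiver, is a brick if its only
endomorphisms are the scalars. -/
def IsBrick {k ι α β : Type*} [Field k] [Fintype α] [Fintype β] [DecidableEq α] [DecidableEq β]
    (M : ι → Matrix α β k) : Prop :=
  ∀ (φ : Matrix α α k) (ψ : Matrix β β k),
    (∀ i, φ * M i = M i * ψ) → ∃ c : k, φ = c • 1 ∧ ψ = c • 1

/-- There is a brick with dimension vector `(a, b)` over the Kronecker quiver with `n` arrows. -/
def HasBrick (k : Type*) [Field k] (n a b : ℕ) : Prop :=
  ∃ M : Fin n → Matrix (Fin a) (Fin b) k, IsBrick M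

section Brick

variable {k ι α β γ α' β' : Type*} [Field k] [Fintype α] [Fintype β] [DecidableEq α] [DecidableEq β]
  [Fintype α'] [Fintype β'] [DecidableEq α'] [DecidableEq β']

theorem IsBrick.reindex {M : ι → Matrix α β k} (hM : IsBrick M) (e : α ≃ α') (f : β ≃ β') :
    IsBrick fun i => Matrix.reindex e f (M i) := by
  intro φ ψ h
  obtain ⟨c, hφ, hψ⟩ := hM (φ.submatrix e e) (ψ.submatrix f f) fun i => by
    have := congrArg (fun X => X.submatrix e f) (h i)
    simp only [Matrix.reindex_apply] at this
    rw [← Matrix.submatrix_mul_equiv _ _ e e f, ← Matrix.submatrix_mul_equiv _ _ e f f] at this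
    simpa using this
  refine ⟨c, ?_, ?_⟩
  · ext i j
    simpa [Matrix.one_apply] using congrFun (congrFun hφ (e.symm i)) (e.symm j)
  · ext i j
    simpa [Matrix.one_apply] using congrFun (congrFun hψ (f.symm i)) (f.symm j)

theorem IsBrick.hasBrick {n : ℕ} {M : Fin n → Matrix α β k} (hM : IsBrick M) :
    HasBrick k n (Fintype.card α) (Fintype.card β) :=
  ⟨_, hM.reindex (Fintype.equivFin α) (Fintype.equivFin β)⟩

theorem IsBrick.transpose {M : ι → Matrix α β k} (hM : IsBrick M) :
    IsBrick fun i => (M i).transpose := by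
  intro φ ψ h
  obtain ⟨c, h₁, h₂⟩ := hM ψ.transpose φ.transpose fun i => by
    simpa using (congrArg Matrix.transpose (h i)).symm
  exact ⟨c, by simpa using congrArg Matrix.transpose h₂,
    by simpa using congrArg Matrix.transpose h₁⟩

theorem IsBrick.eq_zero_of_forall_mul_eq_zero [Nonempty α] {M : ι → Matrix α β k}
    (hM : IsBrick M) {Q : Matrix β γ k} (hQ : ∀ i, M i * Q = 0) : Q = 0 := by
  ext y z
  obtain ⟨c, h₁, h₂⟩ := hM 0 (Matrix.of fun x _ => Q x z) fun i => by
    ext u v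
    simpa [Matrix.mul_apply] using (congrFun (congrFun (hQ i) u) z).symm
  have hc : c = 0 := by
    obtain ⟨x⟩ := ‹Nonempty α›
    simpa using (congrFun (congrFun h₁ x) x).symm
  simpa [hc] using congrFun (congrFun h₂ y) y

theorem IsBrick.eq_zero_of_forall_eq_mul_zero [Nonempty β] {M : ι → Matrix α β k}
    (hM : IsBrick M) {P : Matrix γ α k} (hP : ∀ i, P * M i = 0) : P = 0 := by
  have := hM.transpose.eq_zero_of_forall_mul_eq_zero (Q := P.transpose) fun i => by
    rw [← Matrix.transpose_mul, hP, Matrix.transpose_zero]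
  simpa using congrArg Matrix.transpose this

/-- Adding one arrow and a full block of columns on which only that arrow acts. -/
theorem IsBrick.cons_fromCols [Nonempty α] {n : ℕ} {M : Fin n → Matrix α β k} (hM : IsBrick M) :
    IsBrick (Fin.cons (Matrix.fromCols 0 1) fun i => Matrix.fromCols (M i) 0 :
      Fin (n + 1) → Matrix α (β ⊕ α) k) := by
  intro φ ψ h
  obtain ⟨P, Q, R, T, rfl⟩ : ∃ P Q R T, ψ = Matrix.fromBlocks P Q R T :=
    ⟨_, _, _, _, (Matrix.fromBlocks_toBlocks ψ).symm⟩
  have h₀ := h 0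
  have hs := fun i : Fin n => h i.succ
  simp [Matrix.mul_fromCols, Matrix.fromCols_mul_fromBlocks, Matrix.fromCols_ext_iff] at h₀ hs
  obtain ⟨c, hφ, hP⟩ := hM φ P fun i => (hs i).1
  have hQ : Q = 0 := hM.eq_zero_of_forall_mul_eq_zero fun i => (hs i).2.symm
  refine ⟨c, hφ, ?_⟩
  rw [← h₀.1, ← h₀.2, hQ, hP, hφ, ← Matrix.fromBlocks_one, Matrix.fromBlocks_smul]
  simp

/-- Three matrices of size `α × (α ⊕ γ)`: identity, regular diagonal, and a row of ones at `x₀`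
together with the coordinate inclusion of `γ` into the complement of `x₀`. -/
theorem isBrick_diagonal [Fintype γ] [DecidableEq γ] {d : α → k}
    (hd : Function.Injective d) {f : γ → α} (hf : Function.Injective f) {x₀ : α} (hx₀ : ∀ g, f g ≠ x₀) :
    IsBrick ![Matrix.fromCols 1 (0 : Matrix α γ k), Matrix.fromCols (Matrix.diagonal d) 0,
      Matrix.fromCols (Matrix.of fun x _ => if x = x₀ then 1 else 0)
        (Matrix.of fun x g => if f g = x then 1 else 0)] := by
  intro φ ψ h
  obtain ⟨P, Q, R, T, rfl⟩ : ∃ P Q R T, ψ = Matrix.fromBlocks P Q R T :=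
    ⟨_, _, _, _, (Matrix.fromBlocks_toBlocks ψ).symm⟩
  have h₀ := h 0
  have h₁ := h 1
  have h₂ := h 2
  simp [Matrix.mul_fromCols, Matrix.fromCols_mul_fromBlocks, Matrix.fromCols_ext_iff]
    at h₀ h₁ h₂
  obtain ⟨rfl, rfl⟩ := h₀
  obtain ⟨h₂, h₃⟩ := h₂
  have hdiag : ∀ x y, x ≠ y → φ x y = 0 := by
    intro x y hxy
    have := congrFun (congrFun h₁.1 x) y
    simp only [Matrix.mul_diagonal, Matrix.diagonal_mul] at this
    have h' : (d x - d y) * φ x y = 0 := by linear_combination -this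
    exact (mul_eq_zero.mp h').resolve_left (sub_ne_zero.mpr fun e => hxy (hd e))
  have hsum : ∀ y, ∑ x, φ x y = φ y y := fun y =>
    Finset.sum_eq_single y (fun x _ hx => hdiag x y hx) (by simp)
  have hφ : φ = φ x₀ x₀ • 1 := by
    ext x y
    by_cases hxy : x = y
    · subst hxy
      have := congrFun (congrFun h₂ x₀) x
      simp [Matrix.mul_apply, hx₀, hsum] at this
      simp [this]
    · simp [hxy, hdiag x y hxy]
  generalize φ x₀ x₀ = c at hφ
  subst hφ
  refine ⟨c, rfl, ?_⟩
  have hR : R = 0 := by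
    ext g y
    have := congrFun (congrFun h₂ (f g)) y
    simpa [Matrix.mul_apply, hx₀, hf.eq_iff] using this.symm
  have hT : T = c • 1 := by
    ext g y
    have := congrFun (congrFun h₃ (f g)) y
    simp [Matrix.mul_apply, hf.eq_iff] at this
    simp [← this, Matrix.one_apply, hf.eq_iff]
  rw [hR, hT, ← Matrix.fromBlocks_one, Matrix.fromBlocks_smul]
  simp

/-- A surjective matrix has a right inverse and a matrix whose columns form a basis of its
kernel. -/
theorem Matrix.exists_rightInverse_and_kernel {m : ℕ} {C : Matrix α β k}
    (hC : Function.Surjective C.mulVec) (hm : Fintype.card β = Fintype.card α + m) :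
    ∃ (D : Matrix β α k) (K : Matrix β (Fin m) k), C * D = 1 ∧ C * K = 0 ∧
      (∀ v, C.mulVec v = 0 → ∃ w, K.mulVec w = v) ∧ Function.Injective K.mulVec := by
  let L := Matrix.toLin' C
  have hL : LinearMap.range L = ⊤ := LinearMap.range_eq_top.mpr hC
  obtain ⟨D, hD⟩ := L.exists_rightInverse_of_surjective hL
  have hker : Module.finrank k (LinearMap.ker L) = m := by
    have := L.finrank_range_add_finrank_ker
    rw [hL] at this
    simp at this
    omega
  let e : (Fin m → k) ≃ₗ[k] LinearMap.ker L :=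
    LinearEquiv.ofFinrankEq _ _ (by simp [hker])
  let K := (LinearMap.ker L).subtype ∘ₗ e.toLinearMap
  have hK : ∀ w, (LinearMap.toMatrix' K).mulVec w = e w := fun w => by
    rw [← Matrix.toLin'_apply, Matrix.toLin'_toMatrix']; rfl
  refine ⟨LinearMap.toMatrix' D, LinearMap.toMatrix' K, ?_, ?_, ?_, ?_⟩
  · apply Matrix.toLin'.injective
    rw [Matrix.toLin'_mul, Matrix.toLin'_toMatrix', Matrix.toLin'_one]
    exact hD
  · apply Matrix.toLin'.injective
    rw [Matrix.toLin'_mul, Matrix.toLin'_toMatrix']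
    rw [map_zero]
    exact LinearMap.ext fun w => LinearMap.mem_ker.mp (e w).2
  · intro v hv
    exact ⟨e.symm ⟨v, hv⟩, by rw [hK]; simp⟩
  · intro w w' h
    rw [hK, hK] at h
    exact e.injective (Subtype.ext h)

/-- The reflection functor at the sink sends bricks to bricks. -/
theorem IsBrick.exists_reflection [Nonempty β] [Fintype ι] [DecidableEq ι]
    {M : ι → Matrix α β k} (hM : IsBrick M) {m : ℕ}
    (hm : Fintype.card ι * Fintype.card β = Fintype.card α + m) :
    ∃ N : ι → Matrix β (Fin m) k, IsBrick N := by
  let C : Matrix α (ι × β) k := Matrix.of fun x p => M p.1 x p.2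
  have hC : Function.Surjective C.mulVec := by
    by_contra hC
    obtain ⟨f, hf, hle⟩ := Submodule.exists_le_ker_of_lt_top
      (LinearMap.range (Matrix.toLin' C))
      (lt_top_iff_ne_top.mpr fun h => hC (LinearMap.range_eq_top.mp h))
    have hP : Matrix.of (fun (_ : Unit) x => f fun j => if x = j then 1 else 0) = 0 :=
      hM.eq_zero_of_forall_eq_mul_zero fun i => by
        ext u y
        have := hle (LinearMap.mem_range_self (Matrix.toLin' C) (Pi.single (i, y) 1))
        rw [LinearMap.mem_ker, f.pi_apply_eq_sum_univ] at this
        simpa [Matrix.mul_apply, C, mul_comm] using this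
    refine hf (LinearMap.ext fun v => ?_)
    rw [f.pi_apply_eq_sum_univ]
    exact Finset.sum_eq_zero fun x _ => by
      rw [show f (fun j => if x = j then 1 else 0) = 0 from congrFun (congrFun hP ()) x, smul_zero]
  obtain ⟨D, K, hCD, hCK, hker, hinj⟩ :=
    Matrix.exists_rightInverse_and_kernel hC (m := m) (by simpa using hm)
  refine ⟨fun i => Matrix.of fun y z => K (i, y) z, fun φ ψ h => ?_⟩
  let Φ : Matrix (ι × β) (ι × β) k := Matrix.of fun p q => if p.1 = q.1 then φ p.2 q.2 else 0
  have hΦK : Φ * K = K * ψ := by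
    ext ⟨i, y⟩ z
    have := congrFun (congrFun (h i) y) z
    simpa [Matrix.mul_apply, Φ, Fintype.sum_prod_type] using this
  have hfac : C * Φ * D * C = C * Φ := by
    apply Matrix.mulVec_injective
    ext1 v
    obtain ⟨w, hw⟩ := hker (v - D.mulVec (C.mulVec v)) (by
      rw [Matrix.mulVec_sub, Matrix.mulVec_mulVec, hCD, Matrix.one_mulVec, sub_self])
    have h0 : (C * Φ).mulVec (K.mulVec w) = 0 := by
      rw [Matrix.mulVec_mulVec, Matrix.mul_assoc, hΦK, ← Matrix.mul_assoc, hCK]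
      simp
    rw [hw, Matrix.mulVec_sub, sub_eq_zero] at h0
    rw [h0]
    simp [Matrix.mul_assoc]
  obtain ⟨c, -, hφ⟩ := hM (C * Φ * D) φ fun i => by
    ext x y
    have := congrFun (congrFun hfac x) (i, y)
    rw [Matrix.mul_apply] at this ⊢
    refine this.trans ?_
    simp [Matrix.mul_apply, Fintype.sum_prod_type, C, Φ]
  refine ⟨c, hφ, ?_⟩
  apply Matrix.mulVec_injective
  ext1 w
  apply hinj
  rw [Matrix.mulVec_mulVec, ← hΦK]
  have hΦ : Φ = c • 1 := by
    ext ⟨i, y⟩ ⟨j, z⟩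
    simp [Φ, hφ, Matrix.one_apply]
    grind
  simp [hΦ]

end Brick

namespace HasBrick

variable {k : Type*} [Field k] {n a b : ℕ}

theorem swap (h : HasBrick k n a b) : HasBrick k n b a :=
  let ⟨_, hM⟩ := h
  ⟨_, hM.transpose⟩

theorem succ (h : HasBrick k n a b) : HasBrick k (n + 1) a b :=
  let ⟨M, hM⟩ := h
  ⟨Fin.cons 0 M, fun φ ψ h => hM φ ψ fun i => h i.succ⟩

theorem succ_add (ha : 0 < a) (h : HasBrick k n a b) : HasBrick k (n + 1) a (b + a) := by
  obtain ⟨M, hM⟩ := h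
  have : NeZero a := ⟨ha.ne'⟩
  simpa using hM.cons_fromCols.hasBrick

theorem reflect (hb : 0 < b) (h : HasBrick k n a b) {m : ℕ} (hm : n * b = a + m) :
    HasBrick k n b m := by
  obtain ⟨M, hM⟩ := h
  have : NeZero b := ⟨hb.ne'⟩
  exact hM.exists_reflection (by simpa using hm)

theorem three [Infinite k] {r : ℕ} (hr : r < a) : HasBrick k 3 a (a + r) := by
  obtain ⟨s, rfl⟩ : ∃ s, a = r + (s + 1) := ⟨a - r - 1, by omega⟩
  have hd : Function.Injective fun x : Fin (r + (s + 1)) => Infinite.natEmbedding k x :=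
    (Infinite.natEmbedding k).injective.comp Fin.val_injective
  simpa using (isBrick_diagonal hd (Fin.castAdd_injective r (s + 1)) (x₀ := Fin.last (r + s))
    fun g hg => by
      have := congrArg Fin.val hg
      simp at this
      omega).hasBrick

theorem of_le_of_lt [Infinite k] (hn : 3 ≤ n) (hab : a ≤ b) (hlt : b + a < n * a) :
    HasBrick k n a b := by
  induction n, hn using Nat.le_induction generalizing b with
  | base =>
    obtain ⟨r, rfl⟩ := Nat.exists_eq_add_of_le hab
    exact three (by omega)
  | succ n hn ih =>
    rw [Nat.succ_mul] at hlt
    by_cases h : b + a < n * a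
    · exact (ih hab h).succ
    · have : 3 * a ≤ n * a := Nat.mul_le_mul_right a hn
      obtain ⟨c, rfl⟩ := Nat.exists_eq_add_of_le' hab
      exact (ih (by omega) (by omega)).succ_add (by omega)

theorem of_imaginary [Infinite k] (hn : 3 ≤ n) (ha : 0 < a) (hb : 0 < b)
    (h : (a : ℤ) ^ 2 + (b : ℤ) ^ 2 - (n : ℤ) * a * b < 0) : HasBrick k n a b := by
  induction hs : a + b using Nat.strong_induction_on generalizing a b with
  | _ s ih =>
    wlog hab : a ≤ b generalizing a b
    · exact (this hb ha (by linarith) (by omega) (by omega)).swap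
    by_cases hlt : b + a < n * a
    · exact of_le_of_lt hn hab hlt
    have h3 : 3 * a ≤ n * a := Nat.mul_le_mul_right a hn
    have hbn : b < n * a := by
      zify
      have : (0 : ℤ) < b := by exact_mod_cast hb
      nlinarith [sq_nonneg (a : ℤ)]
    obtain ⟨m, hm⟩ := Nat.exists_eq_add_of_lt hbn
    refine reflect (a := m + 1) ha (ih (m + 1 + a) (by omega) (by omega) ha ?_ rfl) (by omega)
    have hm' : (b : ℤ) = n * a - (m + 1) := by
      have : (n : ℤ) * a = b + m + 1 := by exact_mod_cast hm
      linarith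
    rw [hm'] at h
    push_cast
    nlinarith

end HasBrick

theorem stmt_9 (k : Type*) [Field k] [IsAlgClosed k]
    (n a b : ℕ) (hn : 3 ≤ n) (ha : 0 < a) (hb : 0 < b)
    (him : (a : ℤ) ^ 2 + (b : ℤ) ^ 2 - (n : ℤ) * a * b < 0) :
    ∃ M : Fin n → Matrix (Fin a) (Fin b) k,
      ∀ (φ : Matrix (Fin a) (Fin a) k) (ψ : Matrix (Fin b) (Fin b) k),
        (∀ i, φ * M i = M i * ψ) → ∃ lam : k, φ = lam • 1 ∧ ψ = lam • 1 := by
  have : Infinite k := IsAlgClosed.instInfinite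
  exact HasBrick.of_imaginary hn ha hb him
end

section
/- Let j, k, s, t be positive integers such that either k > t, or k = t and j < s. Then A_{j+k}·A_s > A_{s+t}·A_j (equivalently, A_{j+k}/A_j > A_{s+t}/A_s). -/
theorem kroneckerA_add_two (n : ℤ) (i : ℕ) :
    kroneckerA n (i + 2) = n * kroneckerA n (i + 1) - kroneckerA n i := rfl

theorem kroneckerA_nonneg_and_two_mul_lt (n : ℤ) (hn : 3 ≤ n) (i : ℕ) :
    0 ≤ kroneckerA n i ∧ 2 * kroneckerA n i < kroneckerA n (i + 1) := by
  induction i with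
  | zero => simp [kroneckerA]
  | succ i ih =>
    obtain ⟨h0, h1⟩ := ih
    refine ⟨by linarith, ?_⟩
    rw [kroneckerA_add_two]
    nlinarith

theorem kroneckerA_monotone (n : ℤ) (hn : 3 ≤ n) : Monotone (kroneckerA n) :=
  monotone_nat_of_le_succ fun i => by
    have := kroneckerA_nonneg_and_two_mul_lt n hn i
    linarith

theorem kroneckerA_pos (n : ℤ) (hn : 3 ≤ n) {i : ℕ} (hi : 1 ≤ i) : 0 < kroneckerA n i :=
  lt_of_lt_of_le (by simp [kroneckerA]) (kroneckerA_monotone n hn hi)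

theorem kroneckerA_add_add_one (n : ℤ) (i m : ℕ) :
    kroneckerA n (i + m + 1) =
      kroneckerA n (i + 1) * kroneckerA n (m + 1) - kroneckerA n i * kroneckerA n m := by
  induction m generalizing i with
  | zero => simp [kroneckerA]
  | succ m ih =>
    have h := ih (i + 1)
    rw [show i + 1 + m + 1 = i + (m + 1) + 1 by ring] at h
    rw [h, kroneckerA_add_two n i, kroneckerA_add_two n m]
    ring

theorem kroneckerA_succ_mul_sub (n : ℤ) (j d : ℕ) :
    kroneckerA n (j + 1) * kroneckerA n (j + d) - kroneckerA n (j + d + 1) * kroneckerA n j =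
      kroneckerA n d := by
  induction j with
  | zero => simp [kroneckerA]
  | succ j ih =>
    rw [show j + 1 + d = j + d + 1 by ring, kroneckerA_add_two n j, kroneckerA_add_two n (j + d)]
    linear_combination ih

theorem stmt_12 (n : ℤ) (hn : 3 ≤ n) (j k s t : ℕ)
    (hj : 1 ≤ j) (hk : 1 ≤ k) (hs : 1 ≤ s) (ht : 1 ≤ t)
    (h : t < k ∨ (k = t ∧ j < s)) :
    kroneckerA n (j + k) * kroneckerA n s > kroneckerA n (s + t) * kroneckerA n j := by
  rcases h with h | ⟨rfl, h⟩
  · obtain ⟨m, rfl⟩ := Nat.exists_eq_add_of_le' hk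
    obtain ⟨r, rfl⟩ := Nat.exists_eq_add_of_le' hs
    have hj0 := kroneckerA_pos n hn hj
    have hs0 := kroneckerA_pos n hn hs
    have hk0 := kroneckerA_pos n hn hk
    have hj2 := (kroneckerA_nonneg_and_two_mul_lt n hn j).2
    have lower : kroneckerA n j * kroneckerA n (m + 1) < kroneckerA n (j + (m + 1)) := by
      have hm := kroneckerA_monotone n hn (Nat.le_succ m)
      rw [← add_assoc, kroneckerA_add_add_one]
      nlinarith [mul_le_mul_of_nonneg_left hm hj0.le, mul_lt_mul_of_pos_right hj2 hk0]
    have upper : kroneckerA n (r + 1 + t) ≤ kroneckerA n (r + 1) * kroneckerA n (m + 1) := by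
      have hr := (kroneckerA_nonneg_and_two_mul_lt n hn r).1
      have ht0 := kroneckerA_pos n hn ht
      have htm : kroneckerA n (t + 1) ≤ kroneckerA n (m + 1) := kroneckerA_monotone n hn h
      rw [add_right_comm, kroneckerA_add_add_one]
      nlinarith [mul_nonneg hr ht0.le, mul_le_mul_of_nonneg_left htm hs0.le]
    nlinarith [mul_lt_mul_of_pos_right lower hs0, mul_le_mul_of_nonneg_right upper hj0.le]
  · obtain ⟨m, rfl⟩ := Nat.exists_eq_add_of_le' hk
    obtain ⟨d, rfl⟩ := Nat.exists_eq_add_of_le h.le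
    have hd := kroneckerA_pos n hn (i := d) (by lia)
    have key := kroneckerA_succ_mul_sub n j d
    have := mul_pos (kroneckerA_pos n hn hk) hd
    rw [← add_assoc, ← add_assoc, kroneckerA_add_add_one, kroneckerA_add_add_one]
    rw [← key] at this
    linarith
end

section
/- For all positive integers i, j, r, s, t: A_{i+j}·A_t·A_r ≠ A_s·(A_i·A_r + A_j·A_t); that is, A_{i+j}/A_s ≠ A_i/A_t + A_j/A_r. -/
namespace kroneckerA

lemma add_two (n : ℤ) (k : ℕ) :
    kroneckerA n (k + 2) = n * kroneckerA n (k + 1) - kroneckerA n k := rfl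

/-- The Cassini identity. -/
lemma cassini (n : ℤ) (a : ℕ) :
    kroneckerA n (a + 1) * kroneckerA n (a + 1) - kroneckerA n a * kroneckerA n (a + 2) = 1 := by
  induction a with
  | zero => simp [kroneckerA]
  | succ a ih =>
    rw [add_two n (a + 1)]
    rw [add_two n a] at ih ⊢
    linear_combination ih

/-- The Ocagne identity. -/
lemma docagne (n : ℤ) (a j : ℕ) :
    kroneckerA n (a + j) * kroneckerA n (a + 1) - kroneckerA n a * kroneckerA n (a + j + 1)
      = kroneckerA n j := by
  induction j using Nat.twoStepInduction with
  | zero => simp [kroneckerA]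
  | one => exact cassini n a
  | more j h₀ h₁ =>
    have e₀ : kroneckerA n (a + (j + 2))
        = n * kroneckerA n (a + (j + 1)) - kroneckerA n (a + j) := add_two n (a + j)
    have e₁ : kroneckerA n (a + (j + 2) + 1)
        = n * kroneckerA n (a + (j + 1) + 1) - kroneckerA n (a + j + 1) := add_two n (a + j + 1)
    rw [add_two n j]
    linear_combination n * h₁ - h₀ + kroneckerA n (a + 1) * e₀ - kroneckerA n a * e₁

/-- The Vajda identity. -/
lemma vajda (n : ℤ) (a j d : ℕ) :
    kroneckerA n (a + j) * kroneckerA n (a + d) - kroneckerA n a * kroneckerA n (a + j + d)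
      = kroneckerA n j * kroneckerA n d := by
  induction d using Nat.twoStepInduction with
  | zero => simp [kroneckerA, mul_comm]
  | one => simpa [kroneckerA] using docagne n a j
  | more d h₀ h₁ =>
    have e₀ := add_two n (a + d)
    have e₁ := add_two n (a + j + d)
    simp only [← add_assoc] at *
    rw [add_two n d, e₀, e₁]
    linear_combination n * h₁ - h₀

variable {n : ℤ}

lemma nonneg_and_two_mul_lt (hn : 3 ≤ n) (k : ℕ) :
    0 ≤ kroneckerA n k ∧ 2 * kroneckerA n k < kroneckerA n (k + 1) := by
  induction k with
  | zero => simp [kroneckerA]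
  | succ k ih =>
    obtain ⟨h₀, h₁⟩ := ih
    rw [add_two n k]
    exact ⟨by linarith, by nlinarith⟩

lemma nonneg (hn : 3 ≤ n) (k : ℕ) : 0 ≤ kroneckerA n k := (nonneg_and_two_mul_lt hn k).1

lemma two_mul_lt (hn : 3 ≤ n) (k : ℕ) : 2 * kroneckerA n k < kroneckerA n (k + 1) :=
  (nonneg_and_two_mul_lt hn k).2

lemma monotone (hn : 3 ≤ n) : Monotone (kroneckerA n) :=
  monotone_nat_of_le_succ fun k => by linarith [nonneg hn k, two_mul_lt hn k]

lemma pos (hn : 3 ≤ n) {k : ℕ} (hk : 1 ≤ k) : 0 < kroneckerA n k :=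
  one_pos.trans_le (monotone hn hk)

lemma succ_add (n : ℤ) (i j : ℕ) :
    kroneckerA n (i + 1 + j)
      = kroneckerA n (i + 1) * kroneckerA n (j + 1) - kroneckerA n i * kroneckerA n j := by
  have h := vajda n 1 i j
  have h1 : kroneckerA n 1 = 1 := rfl
  rw [add_comm 1 i, add_comm 1 j, h1] at h
  linear_combination -h

lemma two_mul_mul_lt_add (hn : 3 ≤ n) {i j : ℕ} (hi : 1 ≤ i) (hj : 1 ≤ j) :
    2 * (kroneckerA n i * kroneckerA n j) < kroneckerA n (i + j) := by
  obtain ⟨i, rfl⟩ := Nat.exists_eq_add_of_le' hi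
  obtain ⟨j, rfl⟩ := Nat.exists_eq_add_of_le' hj
  rw [succ_add, add_two n j]
  have hx := two_mul_lt hn i
  have hy := two_mul_lt hn j
  have hx₀ := pos hn hi
  have hy₀ := pos hn hj
  have h₁ := mul_pos (sub_pos.2 hx) hy₀
  have h₂ := mul_pos hx₀ (sub_pos.2 hy)
  have h₃ := mul_nonneg (sub_nonneg.2 hn) (mul_pos hx₀ hy₀).le
  linarith

lemma add_le_mul_succ (hn : 3 ≤ n) {i : ℕ} (hi : 1 ≤ i) (j : ℕ) :
    kroneckerA n (i + j) ≤ kroneckerA n i * kroneckerA n (j + 1) := by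
  obtain ⟨i, rfl⟩ := Nat.exists_eq_add_of_le' hi
  rw [succ_add]
  linarith [mul_nonneg (nonneg hn i) (nonneg hn j)]

lemma two_mul_mul_lt_add_mul (hn : 3 ≤ n) {i j s t : ℕ} (hi : 1 ≤ i) (hj : 1 ≤ j) (ht : 1 ≤ t)
    (hs : s < j + t) :
    2 * (kroneckerA n s * kroneckerA n i) < kroneckerA n (i + j) * kroneckerA n t := by
  have h₁ : kroneckerA n s ≤ kroneckerA n j * kroneckerA n t := by
    obtain ⟨t, rfl⟩ := Nat.exists_eq_add_of_le' ht
    exact (monotone hn (by lia : s ≤ j + t)).trans (add_le_mul_succ hn hj t)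
  have h₂ := mul_le_mul_of_nonneg_right h₁ (nonneg hn i)
  have h₃ := mul_lt_mul_of_pos_right (two_mul_mul_lt_add hn hi hj) (pos hn ht)
  linarith

lemma add_mul_lt_mul (hn : 3 ≤ n) {i j s t : ℕ} (hi : 1 ≤ i) (ht : 1 ≤ t)
    (hs : j + t < s) :
    kroneckerA n (i + j) * kroneckerA n t < kroneckerA n s * kroneckerA n i := by
  have h₁ : 2 * (kroneckerA n (j + 1) * kroneckerA n t) < kroneckerA n s :=
    (two_mul_mul_lt_add hn (by lia) ht).trans_le (monotone hn (by lia))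
  have h₂ := mul_lt_mul_of_pos_right h₁ (pos hn hi)
  have h₃ := mul_le_mul_of_nonneg_right (add_le_mul_succ hn hi j) (nonneg hn t)
  have h₄ := mul_pos (mul_pos (pos hn hi) (pos hn (by lia : 1 ≤ j + 1))) (pos hn ht)
  linarith

lemma mul_ne_mul_add (hn : 3 ≤ n) {i j d : ℕ} (r : ℕ) (hi : 1 ≤ i) (hd : 1 ≤ d) :
    kroneckerA n r * kroneckerA n d ≠ kroneckerA n (d + i) * kroneckerA n (d + (i + j)) := by
  rcases Nat.lt_or_ge (i + (d + (i + j))) r with h | h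
  · exact (add_mul_lt_mul hn hd (by lia) h).ne'
  · have h₁ := vajda n d i (i + j)
    rw [show d + i + (i + j) = i + (d + (i + j)) by lia] at h₁
    have h₂ := mul_le_mul_of_nonneg_right (monotone hn h) (nonneg hn d)
    have h₃ := mul_pos (pos hn hi) (pos hn (by lia : 1 ≤ i + j))
    exact ne_of_lt (by linarith)

lemma ne_of_eq_add (hn : 3 ≤ n) {i j t : ℕ} (r : ℕ) (hi : 1 ≤ i) (hj : 1 ≤ j) (ht : 1 ≤ t) :
    kroneckerA n (i + j) * kroneckerA n t * kroneckerA n r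
      ≠ kroneckerA n (j + t) * (kroneckerA n i * kroneckerA n r
          + kroneckerA n j * kroneckerA n t) := by
  intro h
  rcases Nat.le_or_ge t i with hti | hit
  · obtain ⟨d, rfl⟩ := Nat.exists_eq_add_of_le hti
    have hv := vajda n t j d
    rw [add_right_comm, add_comm t j] at hv
    have h₁ := mul_nonneg (mul_nonneg (nonneg hn j) (nonneg hn d)) (nonneg hn r)
    have h₂ := mul_pos (pos hn (by lia : 1 ≤ j + t)) (mul_pos (pos hn hj) (pos hn ht))
    have h₃ : kroneckerA n j * kroneckerA n d * kroneckerA n r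
        + kroneckerA n (j + t) * (kroneckerA n j * kroneckerA n t) = 0 := by
      linear_combination -h - kroneckerA n r * hv
    linarith
  · obtain ⟨d, rfl⟩ := Nat.exists_eq_add_of_le hit
    have hv := vajda n i j d
    have h₁ : kroneckerA n r * kroneckerA n d
        = kroneckerA n (d + i) * kroneckerA n (d + (i + j)) := by
      refine mul_left_cancel₀ (pos hn hj).ne' ?_
      rw [show j + (i + d) = i + j + d by lia] at h
      rw [show d + (i + j) = i + j + d by lia, add_comm d i]
      linear_combination h - kroneckerA n r * hv
    rcases Nat.eq_zero_or_pos d with rfl | hd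
    · have h₂ := mul_pos (pos hn (by lia : 1 ≤ 0 + i)) (pos hn (by lia : 1 ≤ 0 + (i + j)))
      rw [← h₁, show kroneckerA n 0 = 0 from rfl, mul_zero] at h₂
      exact h₂.false
    · exact mul_ne_mul_add hn r hi hd h₁

end kroneckerA

theorem stmt_14 (n : ℤ) (hn : 3 ≤ n) (i j r s t : ℕ)
    (hi : 1 ≤ i) (hj : 1 ≤ j) (hr : 1 ≤ r) (hs : 1 ≤ s) (ht : 1 ≤ t) :
    kroneckerA n (i + j) * kroneckerA n t * kroneckerA n r
      ≠ kroneckerA n s * (kroneckerA n i * kroneckerA n r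
          + kroneckerA n j * kroneckerA n t) := by
  intro h
  have pr := kroneckerA.pos hn hr
  have pt := kroneckerA.pos hn ht
  have ps := kroneckerA.pos hn hs
  have hjt := mul_pos (mul_pos ps (kroneckerA.pos hn hj)) pt
  have hir := mul_pos (mul_pos ps (kroneckerA.pos hn hi)) pr
  rcases lt_trichotomy s (j + t) with h₁ | rfl | h₁
  · rcases lt_trichotomy s (i + r) with h₂ | rfl | h₂
    · have g₁ := mul_lt_mul_of_pos_right (kroneckerA.two_mul_mul_lt_add_mul hn hi hj ht h₁) pr
      have g₂ := mul_lt_mul_of_pos_right (kroneckerA.two_mul_mul_lt_add_mul hn hj hi hr h₂) pt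
      rw [add_comm j i] at g₂
      linarith
    · refine kroneckerA.ne_of_eq_add hn t hj hi hr ?_
      rw [add_comm j i]
      linear_combination h
    · have g := mul_lt_mul_of_pos_right (kroneckerA.add_mul_lt_mul hn hj hr h₂) pt
      rw [add_comm j i] at g
      linarith
  · exact kroneckerA.ne_of_eq_add hn r hi hj ht h
  · have g := mul_lt_mul_of_pos_right (kroneckerA.add_mul_lt_mul hn hi ht h₁) pr
    linarith
end

section
/- For every integer i ≥ 1, the pair (B_{2i−1}, B_{2i+1}) = (A_i − A_{i−1}, A_{i+1} − A_i) consists of positive integers and is an imaginary root of K_n, i.e., (A_i − A_{i−1})² + (A_{i+1} − A_i)² − n·(A_i − A_{i−1})·(A_{i+1} − A_i) < 0. -/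
theorem kroneckerA_nonneg_and_lt_succ {n : ℤ} (hn : 3 ≤ n) (i : ℕ) :
    0 ≤ kroneckerA n i ∧ kroneckerA n i < kroneckerA n (i + 1) := by
  induction i with
  | zero => simp [kroneckerA]
  | succ k ih =>
    obtain ⟨h0, h1⟩ := ih
    rw [kroneckerA_add_two]
    exact ⟨by linarith, by nlinarith⟩

/-- The quadratic form of `K_n` is constant along consecutive differences of `A`. -/
theorem kroneckerA_diff_quadratic_form (n : ℤ) (i : ℕ) :
    (kroneckerA n (i + 1) - kroneckerA n i) ^ 2
      + (kroneckerA n (i + 2) - kroneckerA n (i + 1)) ^ 2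
      - n * (kroneckerA n (i + 1) - kroneckerA n i)
          * (kroneckerA n (i + 2) - kroneckerA n (i + 1)) = 2 - n := by
  induction i with
  | zero => simp [kroneckerA]; ring
  | succ k ih =>
    rw [← ih, kroneckerA_add_two n (k + 1), kroneckerA_add_two n k]
    ring

theorem stmt_15 (n : ℤ) (hn : 3 ≤ n) (i : ℕ) (hi : 1 ≤ i) :
    0 < kroneckerA n i - kroneckerA n (i - 1) ∧
    0 < kroneckerA n (i + 1) - kroneckerA n i ∧
    (kroneckerA n i - kroneckerA n (i - 1)) ^ 2
      + (kroneckerA n (i + 1) - kroneckerA n i) ^ 2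
      - n * (kroneckerA n i - kroneckerA n (i - 1))
          * (kroneckerA n (i + 1) - kroneckerA n i) < 0 := by
  obtain ⟨k, rfl⟩ : ∃ k, i = k + 1 := ⟨i - 1, by omega⟩
  simp only [Nat.add_sub_cancel]
  refine ⟨sub_pos.2 (kroneckerA_nonneg_and_lt_succ hn k).2,
    sub_pos.2 (kroneckerA_nonneg_and_lt_succ hn (k + 1)).2, ?_⟩
  linarith [kroneckerA_diff_quadratic_form n k]
end
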